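/- Let P be an admissible pinnacle set for Z_m ≀ S_n with #P = d, and let E := (Σ_{ξ^a(x) ∈ P} a) + (n−d)(m−1). Then: (i) some witness w of P satisfies ε_w = E; (ii) every witness w of P satisfies ε_w ≤ E; and (iii) for every witness w of P and every integer ℓ with ε_w < ℓ < E, there exists a witness w′ of P with ε_{w′} = ℓ. -/

import Mathlib

open Finset

/-- `Prec p q` means the colored symbol `p = ξ^{p.1}(p.2)` precedes (is smaller than)
`q = ξ^{q.1}(q.2)`: `a > b`, or (`a = b` and `x > y`). -/
def Prec (p q : ℕ × ℕ) : Prop :=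
  q.1 < p.1 ∨ (p.1 = q.1 ∧ q.2 < p.2)

instance : DecidableRel Prec := fun p q => by
  unfold Prec; infer_instance

/-- `w : ℕ → ℕ × ℕ` (read on positions `1,…,n`) is an element of `Z_m ≀ S_n`:
each entry has color `< m` and norm in `{1,…,n}`, and the norms are pairwise distinct. -/
def IsGenPerm (m n : ℕ) (w : ℕ → ℕ × ℕ) : Prop :=
  (∀ i ∈ Finset.Icc 1 n, (w i).1 < m ∧ (w i).2 ∈ Finset.Icc 1 n) ∧
    Set.InjOn (fun i => (w i).2) (Set.Icc 1 n)

/-- The pinnacle set of the word `w`: values at interior positions `2 ≤ i ≤ n-1`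
that strictly dominate both neighbors. -/
def pin (n : ℕ) (w : ℕ → ℕ × ℕ) : Finset (ℕ × ℕ) :=
  ((Finset.Icc 2 (n - 1)).filter
      (fun i => Prec (w (i - 1)) (w i) ∧ Prec (w (i + 1)) (w i))).image w

/-- `P` is an admissible pinnacle set for `Z_m ≀ S_n`. -/
def IsAdmissible (m n : ℕ) (P : Finset (ℕ × ℕ)) : Prop :=
  ∃ w, IsGenPerm m n w ∧ pin n w = P

/-- `APS m n d` : admissible pinnacle sets for `Z_m ≀ S_n` of cardinality at most `d`. -/
def APS (m n d : ℕ) : Set (Finset (ℕ × ℕ)) :=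
  {P | IsAdmissible m n P ∧ P.card ≤ d}

/-- The color sum `ε_w = e_1 + ⋯ + e_n` of a word `w`. -/
def epsSum (n : ℕ) (w : ℕ → ℕ × ℕ) : ℕ :=
  ∑ i ∈ Finset.Icc 1 n, (w i).1

/-- `APSc m p n d` : sets `P` with `#P ≤ d` admitting a witness in the complex
reflection group `G(m,p,n) = {w ∈ Z_m ≀ S_n : ε_w ≡ 0 (mod p)}`. -/
def APSc (m p n d : ℕ) : Set (Finset (ℕ × ℕ)) :=
  {P | (∃ w, IsGenPerm m n w ∧ p ∣ epsSum n w ∧ pin n w = P) ∧ P.card ≤ d}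

lemma Prec.trans {p q r : ℕ × ℕ} (h : Prec p q) (h' : Prec q r) : Prec p r := by
  unfold Prec at *; omega

lemma Prec.asymm {p q : ℕ × ℕ} (h : Prec p q) : ¬ Prec q p := by
  unfold Prec at *; omega

lemma Prec.irrefl (p : ℕ × ℕ) : ¬ Prec p p := by
  unfold Prec; omega

lemma Prec.trans_not {p q r : ℕ × ℕ} (h : Prec p q) (h' : ¬ Prec r q) : Prec p r := by
  unfold Prec at *; omega

/-- Every finite set of colored symbols can be listed increasingly. -/
lemma exists_increasing_enumeration (N : Finset (ℕ × ℕ)) :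
    ∃ v : ℕ → ℕ × ℕ, (∀ i j, i < j → j < N.card → Prec (v i) (v j)) ∧
      (Finset.range N.card).image v = N := by
  let e : ℕ × ℕ ↪ (ℕ ×ₗ ℕ)ᵒᵈ := ⟨fun p => OrderDual.toDual (toLex p), fun _ _ h => h⟩
  have hc : (N.map e).card = N.card := Finset.card_map e
  let f := (N.map e).orderEmbOfFin hc
  refine ⟨fun i => if h : i < N.card then ofLex (OrderDual.ofDual (f ⟨i, h⟩)) else (0, 0), ?_, ?_⟩
  · intro i j hij hj
    have hlt : f ⟨i, hij.trans hj⟩ < f ⟨j, hj⟩ := f.strictMono (by simpa using hij)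
    rw [← OrderDual.ofDual_lt_ofDual, Prod.Lex.lt_iff] at hlt
    simp only [hij.trans hj, hj, dif_pos, Prec]
    rcases hlt with h | h
    · exact Or.inl h
    · exact Or.inr ⟨h.1.symm, h.2⟩
  · ext p
    simp only [Finset.mem_image, Finset.mem_range]
    have hr : ∀ q, q ∈ N.map e ↔ ∃ i, f i = q := by
      intro q
      rw [← Finset.mem_coe, ← Finset.range_orderEmbOfFin (N.map e) hc]
      rfl
    have hp : p ∈ N ↔ e p ∈ N.map e := (Finset.mem_map' e).symm
    rw [hp, hr]
    constructor
    · rintro ⟨i, hi, rfl⟩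
      exact ⟨⟨i, hi⟩, by rw [dif_pos hi]; rfl⟩
    · rintro ⟨i, hi⟩
      exact ⟨i, i.2, by rw [dif_pos i.2]; exact congrArg (fun q => ofLex (OrderDual.ofDual q)) hi⟩

/-- The counting condition that characterizes when `P` is the pinnacle set of some arrangement
of `P ∪ N`. -/
def Dominates (P N : Finset (ℕ × ℕ)) : Prop :=
  ∀ p ∈ P, (P.filter fun q => ¬ Prec p q).card + 1 ≤ (N.filter fun u => Prec u p).card

lemma Dominates.enumeration_prec {P N : Finset (ℕ × ℕ)} (h : Dominates P N)
    {s v : ℕ → ℕ × ℕ}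
    (hs : ∀ i j, i < j → j < P.card → Prec (s i) (s j))
    (hsP : (Finset.range P.card).image s = P)
    (hv : ∀ i j, i < j → j < N.card → Prec (v i) (v j))
    (hvN : (Finset.range N.card).image v = N) {i : ℕ} (hi : i < P.card) :
    i + 1 < N.card ∧ Prec (v (i + 1)) (s i) := by
  have hmem : ∀ j, j < P.card → s j ∈ P := fun j hj => by
    rw [← hsP]; exact Finset.mem_image_of_mem s (Finset.mem_range.2 hj)
  have hlow : i + 1 ≤ (P.filter fun q => ¬ Prec (s i) q).card := by
    have hinj : Set.InjOn s (Finset.range (i + 1)) := by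
      intro a ha b hb hab
      simp only [Finset.coe_range, Set.mem_Iio] at ha hb
      rcases lt_trichotomy a b with hlt | heq | hlt
      · exact absurd (hab ▸ hs a b hlt (by omega)) (Prec.irrefl _)
      · exact heq
      · exact absurd (hab ▸ hs b a hlt (by omega)) (Prec.irrefl _)
    rw [← Finset.card_range (i + 1), ← Finset.card_image_of_injOn hinj]
    refine Finset.card_le_card fun q hq => ?_
    obtain ⟨j, hj, rfl⟩ := Finset.mem_image.1 hq
    rw [Finset.mem_range] at hj
    refine Finset.mem_filter.2 ⟨hmem j (by omega), fun hp => ?_⟩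
    rcases Nat.lt_or_ge j i with hlt | hge
    · exact hp.asymm (hs j i hlt hi)
    · obtain rfl : j = i := by omega
      exact Prec.irrefl _ hp
  have hcount := h (s i) (hmem i hi)
  have hN : (N.filter fun u => Prec u (s i)).card ≤ N.card := Finset.card_filter_le _ _
  have hiN : i + 1 < N.card := by omega
  refine ⟨hiN, ?_⟩
  by_contra hcon
  have hsub : (N.filter fun u => Prec u (s i)) ⊆ (Finset.range (i + 1)).image v := by
    intro u hu
    obtain ⟨huN, hus⟩ := Finset.mem_filter.1 hu
    rw [← hvN] at huN
    obtain ⟨j, hj, rfl⟩ := Finset.mem_image.1 huN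
    rw [Finset.mem_range] at hj
    refine Finset.mem_image_of_mem v (Finset.mem_range.2 ?_)
    by_contra hge
    rcases Nat.lt_or_ge (i + 1) j with hlt | hle
    · exact hcon ((hv _ _ hlt hj).trans hus)
    · obtain rfl : j = i + 1 := by omega
      exact hcon hus
  have := (Finset.card_le_card hsub).trans Finset.card_image_le
  rw [Finset.card_range] at this
  omega

/-- The word interleaving `v 0, s 0, v 1, s 1, …, s (d - 1)` and continuing with
`v d, v (d + 1), …`, read from position `1`. -/
def interleave (d : ℕ) (s v : ℕ → ℕ × ℕ) (j : ℕ) : ℕ × ℕ :=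
  if j - 1 < 2 * d then
    if (j - 1) % 2 = 0 then v ((j - 1) / 2) else s ((j - 1) / 2)
  else v (j - 1 - d)

lemma interleave_even {d : ℕ} (s v : ℕ → ℕ × ℕ) {i : ℕ} (hi : i < d) :
    interleave d s v (2 * i + 2) = s i := by
  have h1 : 2 * i + 2 - 1 < 2 * d := by omega
  have h2 : ¬ (2 * i + 2 - 1) % 2 = 0 := by omega
  have h3 : (2 * i + 2 - 1) / 2 = i := by omega
  simp only [interleave, h1, h2, h3, if_true, if_false]

lemma interleave_odd {d : ℕ} (s v : ℕ → ℕ × ℕ) {i : ℕ} (hi : i ≤ d) :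
    interleave d s v (2 * i + 1) = v i := by
  have h2 : (2 * i + 1 - 1) % 2 = 0 := by omega
  have h3 : (2 * i + 1 - 1) / 2 = i := by omega
  by_cases h1 : 2 * i + 1 - 1 < 2 * d
  · simp only [interleave, h1, h2, h3, if_true]
  · have h4 : 2 * i + 1 - 1 - d = i := by omega
    simp only [interleave, h1, h4, if_false]

lemma interleave_tail {d : ℕ} (s v : ℕ → ℕ × ℕ) {i : ℕ} (hi : d ≤ i) :
    interleave d s v (i + d + 1) = v i := by
  have h1 : ¬ i + d + 1 - 1 < 2 * d := by omega
  have h4 : i + d + 1 - 1 - d = i := by omega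
  simp only [interleave, h1, h4, if_false]

/-- A position `≥ 1` is a peak slot, a valley slot before a peak, or a tail slot. -/
lemma position_cases (d : ℕ) {j : ℕ} (hj : 1 ≤ j) :
    (∃ i < d, j = 2 * i + 2) ∨ (∃ i < d, j = 2 * i + 1) ∨ ∃ i, d ≤ i ∧ j = i + d + 1 := by
  by_cases h : j - 1 < 2 * d
  · rcases Nat.mod_two_eq_zero_or_one (j - 1) with h2 | h2
    · exact Or.inr (Or.inl ⟨(j - 1) / 2, by omega, by omega⟩)
    · exact Or.inl ⟨(j - 1) / 2, by omega, by omega⟩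
  · exact Or.inr (Or.inr ⟨j - 1 - d, by omega, by omega⟩)

/-- If `Dominates P N` holds, then the elements of `P ∪ N` can be
arranged in a word with pinnacle set `P`. -/
lemma Dominates.exists_word {m n : ℕ} {P N : Finset (ℕ × ℕ)} (h : Dominates P N)
    (hsnd : Set.InjOn Prod.snd ((P ∪ N : Finset (ℕ × ℕ)) : Set (ℕ × ℕ)))
    (hrange : ∀ q ∈ P ∪ N, q.1 < m ∧ q.2 ∈ Finset.Icc 1 n)
    (hcard : (P ∪ N).card = n) (hdisj : Disjoint P N) :
    ∃ w, IsGenPerm m n w ∧ pin n w = P ∧ (Finset.Icc 1 n).image w = P ∪ N := by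
  obtain ⟨s, hs, hsP⟩ := exists_increasing_enumeration P
  obtain ⟨v, hv, hvN⟩ := exists_increasing_enumeration N
  have hsv : ∀ i, i < P.card → i + 1 < N.card ∧ Prec (v (i + 1)) (s i) :=
    fun i hi => h.enumeration_prec hs hsP hv hvN hi
  have hvs : ∀ i, i < P.card → Prec (v i) (s i) :=
    fun i hi => (hv i (i + 1) (by omega) (hsv i hi).1).trans (hsv i hi).2
  have hn : P.card + N.card = n := by rw [← hcard, Finset.card_union_of_disjoint hdisj]
  have hdN : P.card ≤ N.card := by
    rcases Nat.eq_zero_or_pos P.card with h0 | h0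
    · omega
    · have := (hsv (P.card - 1) (by omega)).1; omega
  have hs_mem : ∀ i, i < P.card → s i ∈ P := fun i hi => by
    rw [← hsP]; exact Finset.mem_image_of_mem s (Finset.mem_range.2 hi)
  have hv_mem : ∀ i, i < N.card → v i ∈ N := fun i hi => by
    rw [← hvN]; exact Finset.mem_image_of_mem v (Finset.mem_range.2 hi)
  set w := interleave P.card s v with hw
  have himage : (Finset.Icc 1 n).image w = P ∪ N := by
    apply Finset.Subset.antisymm
    · intro q hq
      obtain ⟨j, hj, rfl⟩ := Finset.mem_image.1 hq
      rw [Finset.mem_Icc] at hj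
      rw [Finset.mem_union]
      rcases position_cases P.card hj.1 with ⟨i, hi, rfl⟩ | ⟨i, hi, rfl⟩ | ⟨i, hi, rfl⟩
      · left; rw [hw, interleave_even s v hi]; exact hs_mem i hi
      · right; rw [hw, interleave_odd s v hi.le]; exact hv_mem i (by omega)
      · right; rw [hw, interleave_tail s v hi]; exact hv_mem i (by omega)
    · intro q hq
      rw [Finset.mem_image]
      rcases Finset.mem_union.1 hq with hq | hq
      · rw [← hsP] at hq
        obtain ⟨i, hi, rfl⟩ := Finset.mem_image.1 hq
        rw [Finset.mem_range] at hi
        have := (hsv i hi).1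
        exact ⟨2 * i + 2, Finset.mem_Icc.2 (by omega), interleave_even s v hi⟩
      · rw [← hvN] at hq
        obtain ⟨i, hi, rfl⟩ := Finset.mem_image.1 hq
        rw [Finset.mem_range] at hi
        rcases Nat.lt_or_ge i P.card with hlt | hge
        · exact ⟨2 * i + 1, Finset.mem_Icc.2 (by omega), interleave_odd s v hlt.le⟩
        · exact ⟨i + P.card + 1, Finset.mem_Icc.2 (by omega), interleave_tail s v hge⟩
  have hinj : Set.InjOn w (Finset.Icc 1 n) := by
    apply Finset.injOn_of_card_image_eq
    rw [himage, hcard, Nat.card_Icc, Nat.add_sub_cancel]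
  have hmem : ∀ i ∈ Finset.Icc 1 n, w i ∈ P ∪ N := fun i hi => by
    rw [← himage]; exact Finset.mem_image_of_mem w hi
  refine ⟨w, ⟨fun i hi => hrange _ (hmem i hi), ?_⟩, ?_, himage⟩
  · rw [← Finset.coe_Icc]
    exact fun a ha b hb hab => hinj ha hb (hsnd (hmem a ha) (hmem b hb) hab)
  · apply Finset.Subset.antisymm
    · intro q hq
      obtain ⟨j, hj, rfl⟩ := Finset.mem_image.1 hq
      obtain ⟨hjI, hleft, hright⟩ := Finset.mem_filter.1 hj
      rw [Finset.mem_Icc] at hjI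
      rcases position_cases P.card (show 1 ≤ j by omega) with
        ⟨i, hi, rfl⟩ | ⟨i, hi, rfl⟩ | ⟨i, hi, rfl⟩
      · rw [hw, interleave_even s v hi]; exact hs_mem i hi
      · rw [hw, interleave_even s v hi, interleave_odd s v hi.le] at hright
        exact absurd hright (hvs i hi).asymm
      · rw [hw, show i + P.card + 1 + 1 = (i + 1) + P.card + 1 by ring, interleave_tail s v hi,
          interleave_tail s v (by omega)] at hright
        exact absurd hright (hv i (i + 1) (by omega) (by omega)).asymm
    · intro q hq
      rw [← hsP] at hq
      obtain ⟨i, hi, rfl⟩ := Finset.mem_image.1 hq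
      rw [Finset.mem_range] at hi
      have hlt := (hsv i hi).1
      refine Finset.mem_image.2 ⟨2 * i + 2, Finset.mem_filter.2 ⟨Finset.mem_Icc.2 ?_, ?_, ?_⟩,
        interleave_even s v hi⟩
      · have := (hsv (P.card - 1) (by omega)).1
        omega
      · rw [hw, show 2 * i + 2 - 1 = 2 * i + 1 by omega, interleave_odd s v hi.le,
          interleave_even s v hi]
        exact hvs i hi
      · rw [hw, show 2 * i + 2 + 1 = 2 * (i + 1) + 1 by ring, interleave_odd s v hi,
          interleave_even s v hi]
        exact (hsv i hi).2

/-- The non-pinnacle entries of a word. -/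
def nonPin (n : ℕ) (w : ℕ → ℕ × ℕ) : Finset (ℕ × ℕ) :=
  (Finset.Icc 1 n).image w \ pin n w

lemma pin_subset_image (n : ℕ) (w : ℕ → ℕ × ℕ) : pin n w ⊆ (Finset.Icc 1 n).image w := by
  refine Finset.image_subset_image fun i hi => ?_
  have := Finset.mem_Icc.1 (Finset.mem_filter.1 hi).1
  exact Finset.mem_Icc.2 (by omega)

lemma pin_union_nonPin (n : ℕ) (w : ℕ → ℕ × ℕ) :
    pin n w ∪ nonPin n w = (Finset.Icc 1 n).image w :=
  Finset.union_sdiff_of_subset (pin_subset_image n w)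

lemma disjoint_pin_nonPin (n : ℕ) (w : ℕ → ℕ × ℕ) : Disjoint (pin n w) (nonPin n w) :=
  Finset.disjoint_sdiff

section Witness

variable {m n : ℕ} {w : ℕ → ℕ × ℕ}

lemma IsGenPerm.injOn (h : IsGenPerm m n w) : Set.InjOn w (Finset.Icc 1 n) := by
  rw [Finset.coe_Icc]
  exact fun a ha b hb hab => h.2 ha hb (congrArg Prod.snd hab)

lemma IsGenPerm.card_image (h : IsGenPerm m n w) : ((Finset.Icc 1 n).image w).card = n := by
  rw [Finset.card_image_of_injOn h.injOn, Nat.card_Icc, Nat.add_sub_cancel]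

lemma IsGenPerm.card_nonPin (h : IsGenPerm m n w) : (nonPin n w).card = n - (pin n w).card := by
  rw [nonPin, Finset.card_sdiff_of_subset (pin_subset_image n w), h.card_image]

lemma IsGenPerm.epsSum_eq_sum_image (h : IsGenPerm m n w) :
    epsSum n w = ∑ q ∈ (Finset.Icc 1 n).image w, q.1 :=
  (Finset.sum_image h.injOn).symm

lemma IsGenPerm.epsSum_eq (h : IsGenPerm m n w) :
    epsSum n w = ∑ q ∈ pin n w, q.1 + ∑ q ∈ nonPin n w, q.1 := by
  rw [h.epsSum_eq_sum_image, ← pin_union_nonPin, Finset.sum_union (disjoint_pin_nonPin n w)]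

lemma IsGenPerm.range_of_mem (h : IsGenPerm m n w) {q : ℕ × ℕ}
    (hq : q ∈ (Finset.Icc 1 n).image w) : q.1 < m ∧ q.2 ∈ Finset.Icc 1 n := by
  obtain ⟨i, hi, rfl⟩ := Finset.mem_image.1 hq
  exact h.1 i hi

lemma IsGenPerm.injOn_snd (h : IsGenPerm m n w) :
    Set.InjOn Prod.snd (((Finset.Icc 1 n).image w : Finset (ℕ × ℕ)) : Set (ℕ × ℕ)) := by
  intro p hp q hq hpq
  obtain ⟨i, hi, rfl⟩ := Finset.mem_image.1 hp
  obtain ⟨j, hj, rfl⟩ := Finset.mem_image.1 hq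
  rw [← Finset.mem_coe, Finset.coe_Icc] at hi hj
  rw [h.2 hi hj hpq]

lemma IsGenPerm.epsSum_le (h : IsGenPerm m n w) :
    epsSum n w ≤ ∑ q ∈ pin n w, q.1 + (n - (pin n w).card) * (m - 1) := by
  rw [h.epsSum_eq, ← h.card_nonPin, ← smul_eq_mul]
  refine Nat.add_le_add_left (Finset.sum_le_card_nsmul _ _ _ fun q hq => ?_) _
  have := (h.range_of_mem (Finset.sdiff_subset hq)).1
  omega

/-- An entry that does not dominate both its neighbours is not a pinnacle. -/
lemma IsGenPerm.mem_nonPin (h : IsGenPerm m n w) {j : ℕ} (hj : j ∈ Finset.Icc 1 n)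
    (hnot : ¬ (Prec (w (j - 1)) (w j) ∧ Prec (w (j + 1)) (w j))) : w j ∈ nonPin n w := by
  refine Finset.mem_sdiff.2 ⟨Finset.mem_image_of_mem w hj, fun hmem => ?_⟩
  obtain ⟨k, hk, hkj⟩ := Finset.mem_image.1 hmem
  obtain ⟨hkI, hpk⟩ := Finset.mem_filter.1 hk
  rw [Finset.mem_Icc] at hkI
  obtain rfl : k = j := h.injOn (by simp; omega) (by exact_mod_cast hj) hkj
  exact hnot hpk

lemma IsGenPerm.dominates (h : IsGenPerm m n w) : Dominates (pin n w) (nonPin n w) := by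
  intro p hp
  set T := (Finset.Icc 2 (n - 1)).filter
    (fun i => Prec (w (i - 1)) (w i) ∧ Prec (w (i + 1)) (w i)) with hT
  have hpin : pin n w = T.image w := rfl
  set S := T.filter fun i => ¬ Prec p (w i) with hS
  have hS_spec : ∀ i ∈ S, (2 ≤ i ∧ i ≤ n - 1) ∧
      (Prec (w (i - 1)) (w i) ∧ Prec (w (i + 1)) (w i)) ∧ ¬ Prec p (w i) := by
    intro i hi
    simpa [hS, hT, and_assoc] using hi
  have hSne : S.Nonempty := by
    rw [hpin] at hp
    obtain ⟨i, hi, rfl⟩ := Finset.mem_image.1 hp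
    exact ⟨i, Finset.mem_filter.2 ⟨hi, Prec.irrefl _⟩⟩
  have hle : ((pin n w).filter fun q => ¬ Prec p q).card ≤ S.card := by
    rw [hpin, Finset.filter_image]
    exact Finset.card_image_le
  set i₀ := S.min' hSne
  have hi₀ := hS_spec i₀ (S.min'_mem hSne)
  set J := insert (i₀ - 1) (S.image (· + 1)) with hJ
  have hnotin : i₀ - 1 ∉ S.image (· + 1) := by
    intro hmem
    obtain ⟨i, hi, hii⟩ := Finset.mem_image.1 hmem
    have := S.min'_le i hi
    change i₀ ≤ i at this
    omega
  have hJcard : J.card = S.card + 1 := by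
    rw [hJ, Finset.card_insert_of_notMem hnotin,
      Finset.card_image_of_injective _ (add_left_injective 1)]
  have hJI : J ⊆ Finset.Icc 1 n := by
    intro j hj
    rw [Finset.mem_Icc]
    rcases Finset.mem_insert.1 hj with rfl | hj
    · omega
    · obtain ⟨i, hi, rfl⟩ := Finset.mem_image.1 hj
      have := (hS_spec i hi).1
      omega
  have hJinj : Set.InjOn w J := h.injOn.mono (by exact_mod_cast hJI)
  have hsub : J.image w ⊆ (nonPin n w).filter fun u => Prec u p := by
    intro u hu
    obtain ⟨j, hj, rfl⟩ := Finset.mem_image.1 hu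
    have hjI := hJI hj
    rw [Finset.mem_filter]
    rcases Finset.mem_insert.1 hj with rfl | hj
    · refine ⟨h.mem_nonPin hjI fun hc => ?_, Prec.trans_not hi₀.2.1.1 hi₀.2.2⟩
      have hpk := hc.2
      rw [Nat.sub_add_cancel (by omega)] at hpk
      exact hpk.asymm hi₀.2.1.1
    · obtain ⟨i, hi, rfl⟩ := Finset.mem_image.1 hj
      have hi' := hS_spec i hi
      refine ⟨h.mem_nonPin hjI fun hc => ?_, Prec.trans_not hi'.2.1.2 hi'.2.2⟩
      exact hc.1.asymm hi'.2.1.2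
  have := Finset.card_le_card hsub
  rw [Finset.card_image_of_injOn hJinj] at this
  omega

end Witness

/-- Replacing an element of `N` by a smaller new one preserves domination. -/
lemma Dominates.replace {P N : Finset (ℕ × ℕ)} (h : Dominates P N) {u u' : ℕ × ℕ}
    (hu' : u' ∉ N) (hlt : Prec u' u) : Dominates P (insert u' (N.erase u)) := by
  intro p hp
  refine (h p hp).trans ?_
  refine Finset.card_le_card_of_injOn (fun q => if q = u then u' else q) ?_ ?_
  · intro q hq
    obtain ⟨hqN, hqp⟩ := Finset.mem_filter.1 hq
    refine Finset.mem_coe.2 (Finset.mem_filter.2 ?_)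
    by_cases hqu : q = u
    · subst hqu
      simpa using hlt.trans hqp
    · simp [hqu, hqN, hqp]
  · intro a ha b hb hab
    have haN := (Finset.mem_filter.1 ha).1
    have hbN := (Finset.mem_filter.1 hb).1
    dsimp only at hab
    split_ifs at hab with h1 h2 h2
    · rw [h1, h2]
    · exact absurd (hab ▸ hbN) hu'
    · exact absurd (hab ▸ haN) hu'
    · exact hab

/-- A witness whose color sum is not maximal yields one whose color sum is one larger. -/
lemma IsGenPerm.exists_epsSum_succ {m n : ℕ} {w : ℕ → ℕ × ℕ} (h : IsGenPerm m n w)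
    (hlt : epsSum n w < ∑ q ∈ pin n w, q.1 + (n - (pin n w).card) * (m - 1)) :
    ∃ w', IsGenPerm m n w' ∧ pin n w' = pin n w ∧ epsSum n w' = epsSum n w + 1 := by
  have hex : ∃ u ∈ nonPin n w, u.1 < m - 1 := by
    by_contra! hcon
    have := Finset.card_nsmul_le_sum _ (fun q : ℕ × ℕ => q.1) _ hcon
    rw [h.card_nonPin, smul_eq_mul] at this
    rw [h.epsSum_eq] at hlt
    omega
  obtain ⟨u, hu, hum⟩ := hex
  have huV : u ∈ (Finset.Icc 1 n).image w := Finset.sdiff_subset hu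
  have hNV : nonPin n w ⊆ (Finset.Icc 1 n).image w := Finset.sdiff_subset
  set u' : ℕ × ℕ := (u.1 + 1, u.2) with hu'
  have hne : u' ≠ u := fun he => by simpa [hu'] using congrArg Prod.fst he
  have hu'V : u' ∉ (Finset.Icc 1 n).image w := fun hmem => hne (h.injOn_snd hmem huV rfl)
  have hu'N : u' ∉ nonPin n w := fun hmem => hu'V (hNV hmem)
  have hu'e : u' ∉ (nonPin n w).erase u := fun hmem => hu'N (Finset.mem_of_mem_erase hmem)
  have hdisj : Disjoint (pin n w) (insert u' ((nonPin n w).erase u)) := by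
    rw [Finset.disjoint_insert_right]
    exact ⟨fun hmem => hu'V (pin_subset_image n w hmem),
      (disjoint_pin_nonPin n w).mono_right (Finset.erase_subset _ _)⟩
  have hmem : ∀ q ∈ pin n w ∪ insert u' ((nonPin n w).erase u),
      q = u' ∨ (q ∈ (Finset.Icc 1 n).image w ∧ q ≠ u) := by
    intro q hq
    rcases Finset.mem_union.1 hq with hq | hq
    · exact Or.inr ⟨pin_subset_image n w hq, fun he => (Finset.mem_sdiff.1 hu).2 (he ▸ hq)⟩
    · rcases Finset.mem_insert.1 hq with hq | hq
      · exact Or.inl hq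
      · exact Or.inr ⟨hNV (Finset.mem_of_mem_erase hq), Finset.ne_of_mem_erase hq⟩
  have hcard : (insert u' ((nonPin n w).erase u)).card = (nonPin n w).card := by
    rw [Finset.card_insert_of_notMem hu'e, Finset.card_erase_add_one hu]
  obtain ⟨w', hw', hpin, himage⟩ :=
    (h.dominates.replace hu'N (Or.inl (Nat.lt_succ_self u.1))).exists_word (m := m) (n := n)
    (by
      intro a ha b hb hab
      rcases hmem a ha with rfl | ⟨haV, hau⟩ <;> rcases hmem b hb with rfl | ⟨hbV, hbu⟩
      · rfl
      · exact absurd (h.injOn_snd hbV huV hab.symm) hbu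
      · exact absurd (h.injOn_snd haV huV hab) hau
      · exact h.injOn_snd haV hbV hab)
    (by
      intro q hq
      rcases hmem q hq with rfl | ⟨hqV, -⟩
      · exact ⟨by simp only [hu']; omega, (h.range_of_mem huV).2⟩
      · exact h.range_of_mem hqV)
    (by
      rw [Finset.card_union_of_disjoint hdisj, hcard,
        ← Finset.card_union_of_disjoint (disjoint_pin_nonPin n w), pin_union_nonPin, h.card_image])
    hdisj
  refine ⟨w', hw', hpin, ?_⟩
  rw [hw'.epsSum_eq_sum_image, himage, Finset.sum_union hdisj, Finset.sum_insert hu'e,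
    h.epsSum_eq, ← Finset.add_sum_erase _ _ hu]
  simp only [hu']
  ring

/-- Every color sum between that of a given witness and the maximum is attained. -/
lemma IsGenPerm.exists_epsSum_eq {m n : ℕ} {w : ℕ → ℕ × ℕ} (h : IsGenPerm m n w) {l : ℕ}
    (hl : epsSum n w ≤ l) (hlE : l ≤ ∑ q ∈ pin n w, q.1 + (n - (pin n w).card) * (m - 1)) :
    ∃ w', IsGenPerm m n w' ∧ pin n w' = pin n w ∧ epsSum n w' = l := by
  induction l, hl using Nat.le_induction with
  | base => exact ⟨w, h, rfl, rfl⟩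
  | succ k _ ih =>
    obtain ⟨w₁, h₁, hpin₁, hsum₁⟩ := ih (by omega)
    obtain ⟨w₂, h₂, hpin₂, hsum₂⟩ := h₁.exists_epsSum_succ (by rw [hpin₁]; omega)
    exact ⟨w₂, h₂, hpin₂.trans hpin₁, by omega⟩

/-- The canonical witness maximizes `ε`; every witness has `ε_w ≤ E`; and every
intermediate value between `ε_w` and `E` is attained by some witness. -/
theorem eps_range_of_witnesses (m n d : ℕ) (hm : 1 ≤ m) (hn : 1 ≤ n)
    (P : Finset (ℕ × ℕ)) (hP : IsAdmissible m n P) (hd : P.card = d) :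
    (∃ w, IsGenPerm m n w ∧ pin n w = P ∧
        epsSum n w = (∑ p ∈ P, p.1) + (n - d) * (m - 1)) ∧
      (∀ w, IsGenPerm m n w → pin n w = P →
        epsSum n w ≤ (∑ p ∈ P, p.1) + (n - d) * (m - 1)) ∧
      ∀ w, IsGenPerm m n w → pin n w = P →
        ∀ l : ℕ, epsSum n w < l → l < (∑ p ∈ P, p.1) + (n - d) * (m - 1) →
          ∃ w', IsGenPerm m n w' ∧ pin n w' = P ∧ epsSum n w' = l := by
  subst hd
  refine ⟨?_, ?_, ?_⟩
  · obtain ⟨w, hw, rfl⟩ := hP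
    exact hw.exists_epsSum_eq hw.epsSum_le le_rfl
  · rintro w hw rfl
    exact hw.epsSum_le
  · rintro w hw rfl l hl hlE
    exact hw.exists_epsSum_eq hl.le hlE.le
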